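/- Let G and Γ be finite groups and let X and Y be (G × Γ)-sets such that the subgroup {1} × Γ acts freely on X. For n ≥ 1, let P_n be the set of tuples (c₁, …, c_n) ∈ ((X × X × Y)/Γ)^n such that for every 1 ≤ i < n, the image of c_i under the map induced by (x, x′, y) ↦ (x′, y) equals the image of c_{i+1} under the map induced by (x, x′, y) ↦ (x, y) in (X × Y)/Γ. Then the map (X^{n+1} × Y)/Γ → P_n sending the class of (x₀, …, x_n, y) to ([(x₀, x₁, y)], …, [(x_{n−1}, x_n, y)]) is a well-defined G-equivariant bijection. -/

import Mathlib

section

variable (G Γ : Type*) [Group G] [Group Γ]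

/-- The orbit relation of the `Γ`-action (via `{1} × Γ ⊆ G × Γ`) on a `(G × Γ)`-set `Z`. -/
def gammaRel (Z : Type*) [MulAction (G × Γ) Z] : Z → Z → Prop :=
  fun z z' => ∃ γ : Γ, ((1, γ) : G × Γ) • z = z'

/-- The quotient `Z/Γ` of a `(G × Γ)`-set `Z` by the action of `{1} × Γ`. -/
def gammaQuot (Z : Type*) [MulAction (G × Γ) Z] : Type _ :=
  Quot (gammaRel G Γ Z)

/-- The residual `G`-action on the quotient `Z/Γ`. -/
def gammaSmul {Z : Type*} [MulAction (G × Γ) Z] (g : G) :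
    gammaQuot G Γ Z → gammaQuot G Γ Z :=
  Quot.map (fun z => ((g, 1) : G × Γ) • z)
    (by
      rintro z _ ⟨γ, rfl⟩
      refine ⟨γ, ?_⟩
      show ((1, γ) : G × Γ) • ((g, 1) : G × Γ) • z = ((g, 1) : G × Γ) • ((1, γ) : G × Γ) • z
      rw [smul_smul, smul_smul]
      congr 1
      simp)

/-- The map `Z/Γ → W/Γ` induced by a `(G × Γ)`-equivariant map `f : Z → W`. -/
def gammaMap {Z W : Type*} [MulAction (G × Γ) Z] [MulAction (G × Γ) W]
    (f : Z → W) (hf : ∀ (p : G × Γ) (z : Z), f (p • z) = p • f z) :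
    gammaQuot G Γ Z → gammaQuot G Γ W :=
  Quot.map f (by rintro z _ ⟨γ, rfl⟩; exact ⟨γ, (hf _ z).symm⟩)

variable {G Γ}

theorem gammaMap_gammaSmul {Z W : Type*} [MulAction (G × Γ) Z] [MulAction (G × Γ) W]
    (f : Z → W) (hf : ∀ (p : G × Γ) (z : Z), f (p • z) = p • f z) (g : G)
    (z : gammaQuot G Γ Z) :
    gammaMap G Γ f hf (gammaSmul G Γ g z) = gammaSmul G Γ g (gammaMap G Γ f hf z) := by
  induction z using Quot.ind with
  | _ z => exact congrArg (Quot.mk _) (hf _ z)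

variable (G Γ)
variable (X Y : Type*) [MulAction (G × Γ) X] [MulAction (G × Γ) Y]

/-- The map `(X × X × Y)/Γ → (X × Y)/Γ` induced by `(x, x′, y) ↦ (x′, y)`. -/
def dTail : gammaQuot G Γ (X × X × Y) → gammaQuot G Γ (X × Y) :=
  gammaMap G Γ (fun z => (z.2.1, z.2.2)) (fun _ _ => rfl)

/-- The map `(X × X × Y)/Γ → (X × Y)/Γ` induced by `(x, x′, y) ↦ (x, y)`. -/
def dHead : gammaQuot G Γ (X × X × Y) → gammaQuot G Γ (X × Y) :=
  gammaMap G Γ (fun z => (z.1, z.2.2)) (fun _ _ => rfl)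

/-- The set `P_n` of `n`-tuples of classes in `(X × X × Y)/Γ` whose consecutive members
match in `(X × Y)/Γ`. -/
def Pn (n : ℕ) : Type _ :=
  {c : Fin n → gammaQuot G Γ (X × X × Y) //
    ∀ (i : Fin n) (h : (i : ℕ) + 1 < n),
      dTail G Γ X Y (c i) = dHead G Γ X Y (c ⟨(i : ℕ) + 1, h⟩)}

/-- The residual `G`-action on `P_n`, acting componentwise. -/
def PnSmul (n : ℕ) (g : G) (c : Pn G Γ X Y n) : Pn G Γ X Y n :=
  ⟨fun i => gammaSmul G Γ g (c.1 i), by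
    intro i h
    show gammaMap G Γ _ _ (gammaSmul G Γ g (c.1 i)) =
      gammaMap G Γ _ _ (gammaSmul G Γ g (c.1 ⟨(i : ℕ) + 1, h⟩))
    rw [gammaMap_gammaSmul, gammaMap_gammaSmul]
    exact congrArg _ (c.2 i h)⟩

/-- The canonical map `(X^{n+1} × Y)/Γ → P_n` sending the class of `(x₀, …, x_n, y)` to
`([(x₀, x₁, y)], …, [(x_{n−1}, x_n, y)])`. -/
def PhiMap (n : ℕ) :
    gammaQuot G Γ ((Fin (n + 1) → X) × Y) → Pn G Γ X Y n :=
  Quot.lift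
    (fun p : (Fin (n + 1) → X) × Y =>
      (⟨fun i => Quot.mk _ (p.1 i.castSucc, p.1 i.succ, p.2),
        by
          intro i h
          apply congrArg (Quot.mk _)
          rfl⟩ : Pn G Γ X Y n))
    (by
      rintro p q ⟨γ, hγ⟩
      apply Subtype.ext
      funext i
      refine Quot.sound ⟨γ, ?_⟩
      have hx : ((1, γ) : G × Γ) • p.1 = q.1 := congrArg Prod.fst hγ
      have hy : ((1, γ) : G × Γ) • p.2 = q.2 := congrArg Prod.snd hγ
      rw [← hx, ← hy]
      rfl)

theorem gammaQuot_mk_eq_iff {Z : Type*} [MulAction (G × Γ) Z] (z w : Z) :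
    (Quot.mk _ z : gammaQuot G Γ Z) = Quot.mk _ w ↔ ∃ γ : Γ, ((1, γ) : G × Γ) • z = w := by
  have hequiv : Equivalence (gammaRel G Γ Z) := by
    refine ⟨fun z => ⟨1, one_smul (G × Γ) z⟩, ?_, ?_⟩
    · rintro z _ ⟨γ, rfl⟩
      exact ⟨γ⁻¹, by simpa using inv_smul_smul ((1, γ) : G × Γ) z⟩
    · rintro z _ _ ⟨γ, rfl⟩ ⟨δ, rfl⟩
      exact ⟨δ * γ, by simp [smul_smul]⟩
  exact hequiv.quot_mk_eq_iff z w

/-- A class in `(X × X × Y)/Γ` has a representative with any prescribed representative of its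
image under `dHead`. -/
theorem exists_eq_mk_of_dHead_eq (c : gammaQuot G Γ (X × X × Y)) (x : X) (y : Y)
    (h : dHead G Γ X Y c = Quot.mk _ (x, y)) : ∃ x' : X, c = Quot.mk _ (x, x', y) := by
  induction c using Quot.ind with
  | _ z =>
    obtain ⟨a, b, w⟩ := z
    obtain ⟨γ, hγ⟩ := (gammaQuot_mk_eq_iff G Γ (a, w) (x, y)).1 h
    obtain ⟨rfl, rfl⟩ := Prod.mk.inj hγ
    exact ⟨((1, γ) : G × Γ) • b, Quot.sound ⟨γ, rfl⟩⟩

theorem PhiMap_injective (n : ℕ) (hn : 1 ≤ n)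
    (hfree : ∀ (γ : Γ) (x : X), ((1, γ) : G × Γ) • x = x → γ = 1) :
    Function.Injective (PhiMap G Γ X Y n) := by
  intro z w hzw
  induction z using Quot.ind with
  | _ p =>
  induction w using Quot.ind with
  | _ q =>
    have hex : ∀ i : Fin n, ∃ γ : Γ, ((1, γ) : G × Γ) • p.1 i.castSucc = q.1 i.castSucc ∧
        ((1, γ) : G × Γ) • p.1 i.succ = q.1 i.succ ∧ ((1, γ) : G × Γ) • p.2 = q.2 := by
      intro i
      obtain ⟨γ, hγ⟩ := (gammaQuot_mk_eq_iff G Γ (p.1 i.castSucc, p.1 i.succ, p.2)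
        (q.1 i.castSucc, q.1 i.succ, q.2)).1 (congrFun (congrArg Subtype.val hzw) i)
      obtain ⟨h₀, h⟩ := Prod.mk.inj hγ
      exact ⟨γ, h₀, Prod.mk.inj h⟩
    obtain ⟨γ, h₀, -, hy⟩ := hex ⟨0, hn⟩
    refine Quot.sound ⟨γ, Prod.ext (funext fun j => ?_) hy⟩
    change ((1, γ) : G × Γ) • p.1 j = q.1 j
    induction j using Fin.induction with
    | zero => exact h₀
    | succ i ih =>
      obtain ⟨δ, hδ, hδ', -⟩ := hex i
      have hone : γ⁻¹ * δ = 1 := by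
        apply hfree _ (p.1 i.castSucc)
        have hmul : ((1, γ⁻¹ * δ) : G × Γ) = (1, γ)⁻¹ * (1, δ) := by simp
        rw [hmul, mul_smul, hδ, ← ih, inv_smul_smul]
      rw [inv_mul_eq_one.1 hone, hδ']

theorem PhiMap_surjective (n : ℕ) (hn : 1 ≤ n) :
    Function.Surjective (PhiMap G Γ X Y n) := by
  intro c
  obtain ⟨⟨x₀, x₁, y⟩, hc₀⟩ := Quot.exists_rep (c.1 ⟨0, hn⟩)
  have hnext : ∀ (i : Fin n) (x : X), ∃ x' : X,
      dHead G Γ X Y (c.1 i) = Quot.mk _ (x, y) → c.1 i = Quot.mk _ (x, x', y) := by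
    intro i x
    by_cases h : dHead G Γ X Y (c.1 i) = Quot.mk _ (x, y)
    · obtain ⟨x', hx'⟩ := exists_eq_mk_of_dHead_eq G Γ X Y (c.1 i) x y h
      exact ⟨x', fun _ => hx'⟩
    · exact ⟨x, fun h' => absurd h' h⟩
  choose f hf using hnext
  let s : Fin (n + 1) → X := fun j => Fin.induction (motive := fun _ => X) x₀ f j
  have hhead : ∀ (k : ℕ) (hk : k < n),
      dHead G Γ X Y (c.1 ⟨k, hk⟩) = Quot.mk _ (s (Fin.castSucc ⟨k, hk⟩), y) := by
    intro k
    induction k with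
    | zero =>
      intro hk
      rw [← hc₀]
      rfl
    | succ k ih =>
      intro hk
      have hk' : k < n := Nat.lt_of_succ_lt hk
      rw [← c.2 ⟨k, hk'⟩ hk, hf _ _ (ih hk')]
      rfl
  refine ⟨Quot.mk _ (s, y), Subtype.ext (funext fun i => ?_)⟩
  exact (hf i _ (hhead i i.2)).symm

theorem PhiMap_gammaSmul (n : ℕ) (g : G) (z : gammaQuot G Γ ((Fin (n + 1) → X) × Y)) :
    PhiMap G Γ X Y n (gammaSmul G Γ g z) = PnSmul G Γ X Y n g (PhiMap G Γ X Y n z) := by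
  induction z using Quot.ind with
  | _ p => rfl

/-- **Levelwise form of `N(X̃ × Y)/Γ ≅ N((X̃ × Y)/Γ)`.**
Let `G` and `Γ` be finite groups and `X`, `Y` be `(G × Γ)`-sets such that `{1} × Γ` acts
freely on `X`.  For `n ≥ 1`, the map `(X^{n+1} × Y)/Γ → P_n` sending the class of
`(x₀, …, x_n, y)` to `([(x₀, x₁, y)], …, [(x_{n−1}, x_n, y)])` is a well-defined
`G`-equivariant bijection. -/
theorem stmt3 [Fintype G] [Fintype Γ] (n : ℕ) (hn : 1 ≤ n)
    (hfree : ∀ (γ : Γ) (x : X), ((1, γ) : G × Γ) • x = x → γ = 1) :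
    Function.Bijective (PhiMap G Γ X Y n) ∧
      ∀ (g : G) (z : gammaQuot G Γ ((Fin (n + 1) → X) × Y)),
        PhiMap G Γ X Y n (gammaSmul G Γ g z) = PnSmul G Γ X Y n g (PhiMap G Γ X Y n z) :=
  ⟨⟨PhiMap_injective G Γ X Y n hn hfree, PhiMap_surjective G Γ X Y n hn⟩,
    PhiMap_gammaSmul G Γ X Y n⟩

end
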